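/- Assume k = ℂ and Q, q are generic. Then the ℋ^B_{Q,q}(d)-module V_{2d+1}^{⊗d} is a direct summand of a finite direct sum of copies of V_{2d}^{⊗d}: there exist N ≥ 1 and ℂ-linear maps ι : V_{2d+1}^{⊗d} → (V_{2d}^{⊗d})^{⊕N} and π : (V_{2d}^{⊗d})^{⊕N} → V_{2d+1}^{⊗d}, each intertwining the operators T_0, …, T_{d−1} (acting diagonally on the direct sum), with π ∘ ι = Id. -/

import Mathlib

noncomputable section
namespace QSP

variable {k : Type*} [Field k]

/-- Doubled value of a basis index: `val n j = 2*j - (n-1)`, so that the basis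
indices of `V_n` are the integers/half-integers `val/2` in `𝕀_n`. -/
def val (n : ℕ) (j : Fin n) : ℤ := 2 * (j : ℤ) - ((n : ℤ) - 1)

/-- Matrix of the operator `K_Q` on `V_n` in the standard basis. -/
def KQmat (Q : k) (n : ℕ) : Matrix (Fin n) (Fin n) k := fun c b =>
  if val n b = 0 then (if c = b then Q⁻¹ else 0)
  else (if c = Fin.rev b then 1 else 0) + (if val n b < 0 ∧ c = b then Q⁻¹ - Q else 0)

/-- Matrix of the operator `R_q` on `V_n ⊗ V_n` in the standard basis. -/
def Rmat (q : k) (n : ℕ) : Matrix (Fin n × Fin n) (Fin n × Fin n) k := fun c b =>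
  if b.1 = b.2 then (if c = b then q⁻¹ else 0)
  else if b.1 < b.2 then (if c = (b.2, b.1) then 1 else 0)
  else (if c = (b.2, b.1) then 1 else 0) + (if c = b then q⁻¹ - q else 0)

/-- The operators `T_i`, `0 ≤ i ≤ d-1`, on `V_n^{⊗ d}`; `T_0` acts as `K_Q` on the
first tensor factor, and `T_i` (for `i > 0`) acts as `R_q` on the `(i, i+1)`
tensor factors (1-based). -/
def TB (Q q : k) (n d : ℕ) (i : ℕ) : Module.End k ((Fin d → Fin n) → k) :=
  if _h0 : i = 0 then
    if hd : 0 < d then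
      Matrix.toLin' (fun c b =>
        if ∀ j, j ≠ (⟨0, hd⟩ : Fin d) → c j = b j then
          KQmat Q n (c ⟨0, hd⟩) (b ⟨0, hd⟩) else 0)
    else 0
  else if hi : i < d then
    Matrix.toLin' (fun c b =>
      if ∀ j, j ≠ (⟨i - 1, Nat.lt_of_le_of_lt (Nat.pred_le i) hi⟩ : Fin d) →
          j ≠ (⟨i, hi⟩ : Fin d) → c j = b j then
        Rmat q n (c ⟨i - 1, Nat.lt_of_le_of_lt (Nat.pred_le i) hi⟩, c ⟨i, hi⟩)
          (b ⟨i - 1, Nat.lt_of_le_of_lt (Nat.pred_le i) hi⟩, b ⟨i, hi⟩) else 0)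
  else 0

/-- The Jucys–Murphy elements `K_i = T_{i-1} ⋯ T_1 T_0 T_1 ⋯ T_{i-1}` acting on
`V_n^{⊗ d}`, for `1 ≤ i ≤ d` (junk value `1` for `i = 0`). -/
def JM (Q q : k) (n d : ℕ) : ℕ → Module.End k ((Fin d → Fin n) → k)
  | 0 => 1
  | 1 => TB Q q n d 0
  | i + 2 => TB Q q n d (i + 1) * JM Q q n d (i + 1) * TB Q q n d (i + 1)

/-- The element `c_K = K_1 K_2 ⋯ K_d` acting on `V_n^{⊗ d}`. -/
def cK (Q q : k) (n d : ℕ) : Module.End k ((Fin d → Fin n) → k) :=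
  ((List.range d).map (fun i => JM Q q n d (i + 1))).prod


section helpers

lemma KQmat_symm (Q : k) (n : ℕ) (c b : Fin n) : KQmat Q n c b = KQmat Q n b c := by
  unfold KQmat
  by_cases hcb : c = b
  · subst hcb; rfl
  · have h1 : (c = Fin.rev b) ↔ (b = Fin.rev c) := by
      constructor <;> (rintro rfl; simp)
    have hcb' : b ≠ c := fun h => hcb h.symm
    simp only [hcb, hcb', h1, and_false, if_false, add_zero]
    by_cases h2 : b = Fin.rev c
    · subst h2
      have : val n (Fin.rev c) = - val n c := by
        unfold val; rw [Fin.val_rev]; have := c.2; omega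
      simp [this]
    · simp [h2]

lemma Rmat_symm (q : k) (n : ℕ) (c b : Fin n × Fin n) : Rmat q n c b = Rmat q n b c := by
  obtain ⟨c1, c2⟩ := c
  obtain ⟨b1, b2⟩ := b
  unfold Rmat
  simp only [Prod.mk.injEq]
  by_cases h : c1 = b1 ∧ c2 = b2
  · obtain ⟨rfl, rfl⟩ := h; rfl
  · have h' : ¬ (b1 = c1 ∧ b2 = c2) := fun h2 => h ⟨h2.1.symm, h2.2.symm⟩
    by_cases h3 : c1 = b2 ∧ c2 = b1
    · obtain ⟨rfl, rfl⟩ := h3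
      by_cases h4 : c1 = c2
      · subst h4; simp
      · have h5 : c2 ≠ c1 := fun e => h4 e.symm
        simp [h4, h5]
    · have h3' : ¬ (b1 = c2 ∧ b2 = c1) := fun h2 => h3 ⟨h2.2.symm, h2.1.symm⟩
      simp [h, h', h3, h3']

lemma symm_aux {W : Type*} [Fintype W] [DecidableEq W] (M : Matrix W W k)
    (h : ∀ c b, M c b = M b c) :
    (LinearMap.toMatrix' (Matrix.toLin' M)).transpose = LinearMap.toMatrix' (Matrix.toLin' M) := by
  rw [LinearMap.toMatrix'_toLin']
  ext c b
  exact h b c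

lemma apply_aux {W : Type*} [Fintype W] [DecidableEq W] (M : Matrix W W k) (y : W → k) (w : W)
    (f : W → k) (h : ∀ b, M w b = f b) : Matrix.toLin' M y w = ∑ b, f b * y b := by
  rw [Matrix.toLin'_apply]
  exact Finset.sum_congr rfl (fun b _ => congrArg (fun z => z * y b) (h b))

lemma ite_aux {p p' : Prop} [Decidable p] [Decidable p'] {x x' : k} (h : p ↔ p') (hx : x = x') :
    (if p then x else 0) = if p' then x' else 0 := by
  subst hx; simp only [h]

lemma TB_symm (Q q : k) (n d i : ℕ) :
    (LinearMap.toMatrix' (TB Q q n d i)).transpose = LinearMap.toMatrix' (TB Q q n d i) := by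
  unfold TB
  split_ifs
  · refine symm_aux _ (fun c b => ite_aux ?_ (KQmat_symm _ _ _ _))
    simp only [eq_comm]
  · simp
  · refine symm_aux _ (fun c b => ite_aux ?_ (Rmat_symm _ _ _ _))
    simp only [eq_comm]
  · simp

lemma TB_zero_apply (Q q : k) (n d : ℕ) (hd : 0 < d) (y : (Fin d → Fin n) → k)
    (w : Fin d → Fin n) :
    TB Q q n d 0 y w = if val n (w ⟨0, hd⟩) = 0 then Q⁻¹ * y w else
      y (Function.update w ⟨0, hd⟩ (Fin.rev (w ⟨0, hd⟩))) +
        if val n (w ⟨0, hd⟩) < 0 then (Q⁻¹ - Q) * y w else 0 := by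
  have key : ∀ b : Fin d → Fin n, (if ∀ j, j ≠ (⟨0, hd⟩ : Fin d) → w j = b j then
          KQmat Q n (w ⟨0, hd⟩) (b ⟨0, hd⟩) else 0) =
      if val n (w ⟨0, hd⟩) = 0 then (if b = w then Q⁻¹ else 0) else
       (if b = Function.update w ⟨0, hd⟩ (Fin.rev (w ⟨0, hd⟩)) then 1 else 0) +
        (if b = w then (if val n (w ⟨0, hd⟩) < 0 then (Q⁻¹ - Q) else 0) else 0) := by
    intro b
    rw [KQmat_symm]
    have e2 : b = w ↔ (∀ j, j ≠ (⟨0, hd⟩ : Fin d) → w j = b j) ∧ b ⟨0, hd⟩ = w ⟨0, hd⟩ := by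
      constructor
      · rintro rfl; simp
      · rintro ⟨h1, h2⟩
        funext j
        by_cases hj : j = ⟨0, hd⟩
        · rw [hj, h2]
        · rw [h1 j hj]
    have e1 : b = Function.update w ⟨0, hd⟩ (Fin.rev (w ⟨0, hd⟩)) ↔
        (∀ j, j ≠ (⟨0, hd⟩ : Fin d) → w j = b j) ∧ b ⟨0, hd⟩ = Fin.rev (w ⟨0, hd⟩) := by
      rw [Function.eq_update_iff, and_comm]
      simp only [ne_eq, eq_comm]
    simp only [e1, e2]
    by_cases H : (∀ j, j ≠ (⟨0, hd⟩ : Fin d) → w j = b j)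
    · rw [if_pos H]
      unfold KQmat
      simp only [eq_true H, true_and]
      clear e1 e2 H
      split_ifs <;> first | rfl | (exfalso; tauto) | simp
    · rw [if_neg H]; simp [H]
  unfold TB
  rw [dif_pos rfl, dif_pos hd]
  refine (apply_aux _ _ _ _ key).trans ?_
  split_ifs <;> simp [add_mul, Finset.sum_add_distrib]

lemma TB_pos_apply (Q q : k) (n d i : ℕ) (a b : Fin d) (h0 : i ≠ 0) (hb : b.1 = i)
    (ha : a.1 + 1 = i) (y : (Fin d → Fin n) → k)
    (w : Fin d → Fin n) :
    TB Q q n d i y w = if w a = w b then q⁻¹ * y w else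
      y (w ∘ Equiv.swap a b) +
        if w b < w a then (q⁻¹ - q) * y w else 0 := by
  have hi : i < d := hb ▸ b.2
  have hbb : (⟨i, hi⟩ : Fin d) = b := by ext; simp [hb]
  have hp : i - 1 < d := by omega
  have haa : (⟨i - 1, hp⟩ : Fin d) = a := by ext; simp; omega
  have hab : a ≠ b := by intro h; rw [h] at ha; omega
  have key : ∀ v : Fin d → Fin n, (if ∀ j, j ≠ a → j ≠ b → w j = v j then
          Rmat q n (w a, w b) (v a, v b) else 0) =
      if w a = w b then (if v = w then q⁻¹ else 0) else
       (if v = w ∘ Equiv.swap a b then 1 else 0) +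
        (if v = w then (if w b < w a then (q⁻¹ - q) else 0) else 0) := by
    intro v
    rw [Rmat_symm]
    have e2 : v = w ↔ (∀ j, j ≠ a → j ≠ b → w j = v j) ∧ (v a = w a ∧ v b = w b) := by
      constructor
      · rintro rfl; simp
      · rintro ⟨h1, h2, h3⟩
        funext j
        by_cases hj : j = a
        · rw [hj, h2]
        · by_cases hj' : j = b
          · rw [hj', h3]
          · rw [h1 j hj hj']
    have e1 : v = w ∘ Equiv.swap a b ↔
        (∀ j, j ≠ a → j ≠ b → w j = v j) ∧ (v a = w b ∧ v b = w a) := by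
      constructor
      · rintro rfl
        refine ⟨fun j h1 h2 => ?_, ?_, ?_⟩
        · simp [Equiv.swap_apply_of_ne_of_ne h1 h2]
        · simp
        · simp
      · rintro ⟨h1, h2, h3⟩
        funext j
        by_cases hj : j = a
        · subst hj; simp [h2]
        · by_cases hj' : j = b
          · subst hj'; simp [h3]
          · simp [Equiv.swap_apply_of_ne_of_ne hj hj', h1 j hj hj']
    simp only [e1, e2]
    by_cases H : (∀ j, j ≠ a → j ≠ b → w j = v j)
    · rw [if_pos H]
      unfold Rmat
      simp only [eq_true H, true_and, Prod.mk.injEq]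
      rcases lt_trichotomy (w a) (w b) with h | h | h
      · simp [h, h.ne, h.not_gt]
      · simp [h]
      · simp [h, h.ne', h.not_gt]
    · rw [if_neg H]; simp [H]
  unfold TB
  rw [dif_neg h0, dif_pos hi]
  subst hbb haa
  refine (apply_aux _ _ _ _ key).trans ?_
  split_ifs <;> simp [add_mul, Finset.sum_add_distrib]

end helpers

/-- letter map -/
def gl (d : ℕ) (c : Fin (d + 1)) (x : Fin (2 * d)) : Fin (2 * d + 1) :=
  ⟨if x.1 < d then (if d ≤ x.1 + c.1 then x.1 + 1 else x.1)
    else (if x.1 < d + c.1 then x.1 else x.1 + 1), by have := x.2; split_ifs <;> omega⟩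

/-- number of central letters before place `j` -/
def cnt (d : ℕ) (u : Fin d → Fin (2 * d + 1)) (j : Fin d) : ℕ :=
  (Finset.univ.filter (fun i => i < j ∧ (u i).1 = d)).card

/-- weight of a letter -/
def hw (Q q : ℂ) (d : ℕ) (c : Fin (d + 1)) (x : Fin (2 * d)) (m : ℕ) : ℂ :=
  if (gl d c x).1 = d ∧ x.1 < d then Q⁻¹ * q⁻¹ ^ m else 1

/-- weight of a word -/
def aw (Q q : ℂ) (d : ℕ) (c : Fin (d + 1)) (w : Fin d → Fin (2 * d)) : ℂ :=
  ∏ j, hw Q q d c (w j) (cnt d (gl d c ∘ w) j)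

lemma gl_rev (d : ℕ) (c : Fin (d + 1)) (x : Fin (2 * d)) :
    gl d c (Fin.rev x) = Fin.rev (gl d c x) := by
  ext
  simp only [gl, Fin.val_rev]
  have := x.2
  split_ifs <;> omega

lemma hw_ncol (Q q : ℂ) (d : ℕ) (c : Fin (d + 1)) (x : Fin (2 * d)) (m : ℕ)
    (h : (gl d c x).1 ≠ d) : hw Q q d c x m = 1 := by simp [hw, h]

lemma cnt_rev (d : ℕ) (u u' : Fin d → Fin (2 * d + 1)) (h : ∀ i, (u i).1 = d ↔ (u' i).1 = d) :
    cnt d u = cnt d u' := by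
  funext j
  simp only [cnt, h]

lemma aw_update (Q q : ℂ) (hQ : Q ≠ 0) (d : ℕ) (hd : 0 < d) (c : Fin (d + 1))
    (w : Fin d → Fin (2 * d)) :
    aw Q q d c (Function.update w ⟨0, hd⟩ (Fin.rev (w ⟨0, hd⟩))) =
     if (gl d c (w ⟨0, hd⟩)).1 = d then
      (if (w ⟨0, hd⟩).1 < d then Q * aw Q q d c w else Q⁻¹ * aw Q q d c w) else aw Q q d c w := by
  unfold aw
  have hc : cnt d (gl d c ∘ Function.update w ⟨0, hd⟩ (Fin.rev (w ⟨0, hd⟩))) =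
      cnt d (gl d c ∘ w) := by
    apply cnt_rev
    intro i
    by_cases hi : i = ⟨0, hd⟩
    · subst hi
      simp only [Function.comp, Function.update_self, gl_rev, Fin.val_rev]
      have := (gl d c (w ⟨0, hd⟩)).2
      omega
    · simp [hi]
  rw [hc]
  have h0 : cnt d (gl d c ∘ w) ⟨0, hd⟩ = 0 := by
    simp only [cnt, Finset.card_eq_zero, Finset.filter_eq_empty_iff]
    intro i _ h
    exact absurd h.1 (by simp [Fin.lt_def])
  rw [← Finset.mul_prod_erase _ _ (Finset.mem_univ (⟨0, hd⟩ : Fin d)),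
    ← Finset.mul_prod_erase _ (fun j => hw Q q d c (w j) _) (Finset.mem_univ (⟨0, hd⟩ : Fin d))]
  have he : ∏ x ∈ Finset.univ.erase (⟨0, hd⟩ : Fin d),
      hw Q q d c (Function.update w ⟨0, hd⟩ (Fin.rev (w ⟨0, hd⟩)) x) (cnt d (gl d c ∘ w) x) =
      ∏ x ∈ Finset.univ.erase (⟨0, hd⟩ : Fin d), hw Q q d c (w x) (cnt d (gl d c ∘ w) x) := by
    apply Finset.prod_congr rfl
    intro x hx
    rw [Function.update_of_ne (Finset.ne_of_mem_erase hx)]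
  rw [he, h0]
  simp only [Function.update_self]
  have hx := (w ⟨0, hd⟩).2
  have h1 : ((gl d c (Fin.rev (w ⟨0, hd⟩))).1 = d ↔ (gl d c (w ⟨0, hd⟩)).1 = d) := by
    rw [gl_rev, Fin.val_rev]; have := (gl d c (w ⟨0, hd⟩)).2; omega
  have h2 : ((Fin.rev (w ⟨0, hd⟩)).1 < d ↔ ¬ (w ⟨0, hd⟩).1 < d) := by
    rw [Fin.val_rev]; omega
  simp only [hw, h1, h2]
  split_ifs <;> simp_all

lemma cnt_succ (d : ℕ) (u : Fin d → Fin (2 * d + 1)) (a b : Fin d) (hab : a.1 + 1 = b.1) :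
    cnt d u b = cnt d u a + if (u a).1 = d then 1 else 0 := by
  unfold cnt
  have : (Finset.univ.filter (fun i => i < b ∧ (u i).1 = d)) =
      (Finset.univ.filter (fun i => i < a ∧ (u i).1 = d)) ∪
       (if (u a).1 = d then {a} else ∅) := by
    ext i
    simp only [Finset.mem_filter, Finset.mem_univ, true_and, Finset.mem_union, Fin.lt_def]
    split_ifs with h
    · simp only [Finset.mem_singleton, Fin.ext_iff]
      constructor
      · rintro ⟨h1, h2⟩; by_cases i.1 = a.1
        · right; assumption
        · left; exact ⟨by omega, h2⟩
      · rintro (⟨h1, h2⟩ | h1)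
        · exact ⟨by omega, h2⟩
        · have : i = a := Fin.ext h1
          subst this
          exact ⟨by omega, h⟩
    · simp only [Finset.notMem_empty, or_false]
      constructor
      · rintro ⟨h1, h2⟩
        have : i.1 ≠ a.1 := fun e => h (by rw [← Fin.ext e]; exact h2)
        exact ⟨by omega, h2⟩
      · rintro ⟨h1, h2⟩
        exact ⟨by omega, h2⟩
  rw [this, Finset.card_union_of_disjoint]
  · split_ifs <;> simp
  · split_ifs <;> simp

lemma cnt_swap_of_lt (d : ℕ) (u : Fin d → Fin (2 * d + 1)) (a b j : Fin d) (hab : a.1 + 1 = b.1)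
    (hj : j ≠ b) : cnt d (u ∘ Equiv.swap a b) j = cnt d u j := by
  unfold cnt
  apply Finset.card_bij' (fun i _ => Equiv.swap a b i) (fun i _ => Equiv.swap a b i)
  · intro i hi
    simp only [Finset.mem_filter, Finset.mem_univ, true_and, Function.comp] at hi ⊢
    refine ⟨?_, hi.2⟩
    rw [Equiv.swap_apply_def]
    have := hi.1
    simp only [Fin.lt_def, ne_eq, Fin.ext_iff] at *
    split_ifs <;> omega
  · intro i hi
    simp only [Finset.mem_filter, Finset.mem_univ, true_and, Function.comp] at hi ⊢
    refine ⟨?_, by simpa using hi.2⟩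
    rw [Equiv.swap_apply_def]
    have := hi.1
    simp only [Fin.lt_def, ne_eq, Fin.ext_iff] at *
    split_ifs <;> omega
  · simp
  · simp

lemma aw_swap (Q q : ℂ) (hq : q ≠ 0) (d : ℕ) (c : Fin (d + 1))
    (w : Fin d → Fin (2 * d)) (a b : Fin d) (hab : a.1 + 1 = b.1) :
    aw Q q d c (w ∘ Equiv.swap a b) =
     if (gl d c (w a)).1 = d ∧ (gl d c (w b)).1 = d then
      (if (w a).1 < d then (if (w b).1 < d then aw Q q d c w else q⁻¹ * aw Q q d c w)
        else (if (w b).1 < d then q * aw Q q d c w else aw Q q d c w))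
      else aw Q q d c w := by
  have hne : a ≠ b := by intro h; rw [h] at hab; omega
  unfold aw
  set m := cnt d (gl d c ∘ w) with hm
  have hbm : b ∈ Finset.univ.erase a := Finset.mem_erase.2 ⟨hne.symm, Finset.mem_univ _⟩
  have hsplit : ∀ f : Fin d → ℂ, ∏ j, f j = f a * (f b * ∏ j ∈ (Finset.univ.erase a).erase b, f j) := by
    intro f
    rw [← Finset.mul_prod_erase _ _ (Finset.mem_univ a), ← Finset.mul_prod_erase _ _ hbm]
  rw [hsplit, hsplit (fun j => hw Q q d c (w j) (m j))]
  have he : ∏ j ∈ (Finset.univ.erase a).erase b,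
      hw Q q d c ((w ∘ Equiv.swap a b) j) (cnt d (gl d c ∘ w ∘ Equiv.swap a b) j) =
      ∏ j ∈ (Finset.univ.erase a).erase b, hw Q q d c (w j) (m j) := by
    apply Finset.prod_congr rfl
    intro j hj
    have hjb := Finset.ne_of_mem_erase hj
    have hja := Finset.ne_of_mem_erase (Finset.mem_of_mem_erase hj)
    rw [← Function.comp_assoc, cnt_swap_of_lt _ _ _ _ _ hab hjb]
    simp [Equiv.swap_apply_of_ne_of_ne hja hjb, hm]
  rw [he]
  have ma' : cnt d (gl d c ∘ w ∘ Equiv.swap a b) a = m a := by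
    rw [← Function.comp_assoc, cnt_swap_of_lt _ _ _ _ _ hab hne]
  have mb' : cnt d (gl d c ∘ w ∘ Equiv.swap a b) b = m a + if (gl d c (w b)).1 = d then 1 else 0 := by
    rw [cnt_succ _ _ a b hab, ma']; simp
  have mb : m b = m a + if (gl d c (w a)).1 = d then 1 else 0 := by
    rw [hm, cnt_succ _ _ a b hab]; simp
  rw [ma', mb', mb]
  simp only [Function.comp, Equiv.swap_apply_left, Equiv.swap_apply_right]
  generalize ∏ j ∈ (Finset.univ.erase a).erase b, hw Q q d c (w j) (m j) = P
  by_cases h1 : (gl d c (w a)).1 = d <;> by_cases h2 : (gl d c (w b)).1 = d <;>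
    by_cases h3 : (w a).1 < d <;> by_cases h4 : (w b).1 < d <;>
    simp [hw, h1, h2, h3, h4, pow_succ] <;> field_simp

/-- the intertwiner -/
def Amat (Q q : ℂ) (d : ℕ) (c : Fin (d + 1)) :
    Matrix (Fin d → Fin (2 * d)) (Fin d → Fin (2 * d + 1)) ℂ :=
  fun w u => if u = gl d c ∘ w then aw Q q d c w else 0

lemma Amat_mulVec (Q q : ℂ) (d : ℕ) (c : Fin (d + 1)) (y : (Fin d → Fin (2 * d + 1)) → ℂ)
    (w : Fin d → Fin (2 * d)) :
    (Amat Q q d c).mulVec y w = aw Q q d c w * y (gl d c ∘ w) := by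
  simp [Matrix.mulVec, dotProduct, Amat]

lemma A_inter (Q q : ℂ) (hQ : Q ≠ 0) (hq : q ≠ 0) (d : ℕ) (c : Fin (d + 1)) (i : ℕ) (hi : i < d)
    (y : (Fin d → Fin (2 * d + 1)) → ℂ) :
    (Amat Q q d c).mulVec (TB Q q (2 * d + 1) d i y) =
      TB Q q (2 * d) d i ((Amat Q q d c).mulVec y) := by
  funext w
  rw [Amat_mulVec]
  by_cases h0 : i = 0
  · subst h0
    rw [TB_zero_apply _ _ _ _ hi, TB_zero_apply _ _ _ _ hi, Amat_mulVec, Amat_mulVec,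
      aw_update _ _ hQ]
    have hx := (w ⟨0, hi⟩).2
    have v1 : val (2 * d) (w ⟨0, hi⟩) ≠ 0 := by unfold val; push_cast; omega
    have v2 : val (2 * d) (w ⟨0, hi⟩) < 0 ↔ (w ⟨0, hi⟩).1 < d := by unfold val; push_cast; omega
    have v3 : val (2 * d + 1) (gl d c (w ⟨0, hi⟩)) = 0 ↔ (gl d c (w ⟨0, hi⟩)).1 = d := by
      unfold val; push_cast; omega
    have v4 : val (2 * d + 1) (gl d c (w ⟨0, hi⟩)) < 0 ↔ (gl d c (w ⟨0, hi⟩)).1 < d := by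
      unfold val; push_cast; omega
    have e : gl d c ∘ Function.update w ⟨0, hi⟩ (Fin.rev (w ⟨0, hi⟩)) =
        Function.update (gl d c ∘ w) ⟨0, hi⟩ (Fin.rev (gl d c (w ⟨0, hi⟩))) := by
      rw [Function.comp_update, gl_rev]
    rw [if_neg v1, e]
    simp only [Function.comp_apply, v2, v3, v4]
    by_cases hc : (gl d c (w ⟨0, hi⟩)).1 = d
    · have hr : Fin.rev (gl d c (w ⟨0, hi⟩)) = (gl d c ∘ w) ⟨0, hi⟩ := by
        ext; simp only [Fin.val_rev, Function.comp]; omega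
      rw [hr, Function.update_eq_self]
      simp only [hc, if_true]
      split_ifs <;> ring
    · have hs : (gl d c (w ⟨0, hi⟩)).1 < d ↔ (w ⟨0, hi⟩).1 < d := by
        revert hc; simp only [gl]; split_ifs <;> omega
      simp only [hc, if_false, hs]
      split_ifs <;> ring
  · let a : Fin d := ⟨i - 1, by omega⟩
    let b : Fin d := ⟨i, hi⟩
    have hab : a.1 + 1 = b.1 := by simp [a, b]; omega
    rw [TB_pos_apply _ _ _ _ _ a b h0 rfl hab, TB_pos_apply _ _ _ _ _ a b h0 rfl hab,
      Amat_mulVec, Amat_mulVec, aw_swap _ _ hq _ _ _ _ _ hab, ← Function.comp_assoc]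
    simp only [Function.comp_apply]
    generalize aw Q q d c w = A
    have ha := (w a).2
    have hb := (w b).2
    by_cases hc : (gl d c (w a)).1 = d ∧ (gl d c (w b)).1 = d
    · have hg : gl d c (w a) = gl d c (w b) := Fin.ext (hc.1.trans hc.2.symm)
      have hs : (gl d c ∘ w) ∘ Equiv.swap a b = gl d c ∘ w := by
        funext j
        simp only [Function.comp]
        rw [Equiv.swap_apply_def]
        split_ifs with h1 h2
        · rw [h1, hg]
        · rw [h2, hg]
        · rfl
      rw [if_pos hg, if_pos hc, hs]
      have hwa : (w a).1 = d ∨ (w a).1 + 1 = d := by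
        have := hc.1; revert this; simp only [gl]; split_ifs <;> omega
      have hwb : (w b).1 = d ∨ (w b).1 + 1 = d := by
        have := hc.2; revert this; simp only [gl]; split_ifs <;> omega
      simp only [Fin.ext_iff, Fin.lt_def]
      split_ifs <;> first | omega | ring
    · have e1 : gl d c (w a) = gl d c (w b) ↔ w a = w b := by
        constructor
        · intro h
          rw [Fin.ext_iff] at h ⊢
          revert h hc; simp only [gl]; split_ifs <;> omega
        · intro h; rw [h]
      have e2 : gl d c (w b) < gl d c (w a) ↔ w b < w a := by
        rw [Fin.lt_def, Fin.lt_def]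
        revert hc; simp only [gl]; split_ifs <;> omega
      simp only [e1, e2, if_neg hc]
      split_ifs <;> ring

lemma A_inter_mat (Q q : ℂ) (hQ : Q ≠ 0) (hq : q ≠ 0) (d : ℕ) (c : Fin (d + 1)) (i : ℕ)
    (hi : i < d) (y : (Fin d → Fin (2 * d)) → ℂ) :
    (Amat Q q d c).transpose.mulVec (TB Q q (2 * d) d i y) =
      TB Q q (2 * d + 1) d i ((Amat Q q d c).transpose.mulVec y) := by
  have h : Amat Q q d c * LinearMap.toMatrix' (TB Q q (2 * d + 1) d i) =
      LinearMap.toMatrix' (TB Q q (2 * d) d i) * Amat Q q d c := by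
    apply Matrix.toLin'.injective
    ext1 x
    apply LinearMap.ext_ring
    have := A_inter Q q hQ hq d c i hi (Pi.single x 1)
    simpa [Matrix.toLin'_mul] using this
  have h2 := congrArg Matrix.transpose h
  rw [Matrix.transpose_mul, Matrix.transpose_mul, TB_symm, TB_symm] at h2
  have h3 := congrArg (fun M => Matrix.mulVec M y) h2
  simp only [← Matrix.mulVec_mulVec, LinearMap.toMatrix'_mulVec] at h3
  exact h3.symm

/-- local factor of the scalar -/
def Fc (Q q : ℂ) (d : ℕ) (v : Fin (2 * d + 1)) (m : ℕ) : ℂ :=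
  if v.1 = d then 1 + (Q⁻¹ * q⁻¹ ^ m) ^ 2 else 1

/-- the label of `v` is `c` -/
def lab (d : ℕ) (v : Fin (2 * d + 1)) : Fin (d + 1) :=
  ⟨if v.1 < d then d - v.1 else v.1 - d, by have := v.2; split_ifs <;> omega⟩

lemma fiber_sum (Q q : ℂ) (d : ℕ) (c : Fin (d + 1)) (v : Fin (2 * d + 1)) (m : ℕ) :
    ∑ x ∈ Finset.univ.filter (fun x => gl d c x = v), hw Q q d c x m ^ 2 =
      if lab d v = c then 0 else Fc Q q d v m := by
  have hv := v.2
  have hc := c.2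
  by_cases h : lab d v = c
  · rw [if_pos h]
    apply Finset.sum_eq_zero
    intro x hx
    exfalso
    have hx := (Finset.mem_filter.1 hx).2
    rw [Fin.ext_iff] at h hx
    have := x.2
    revert h hx
    simp only [lab, gl]
    split_ifs <;> omega
  · rw [if_neg h]
    by_cases hvd : v.1 = d
    · have hc0 : c.1 ≠ 0 := by
        intro e; apply h; ext; simp [lab, hvd, e]
      have h1 : (d - 1) < 2 * d := by omega
      have h2 : d < 2 * d := by omega
      have : Finset.univ.filter (fun x => gl d c x = v) = {⟨d - 1, h1⟩, ⟨d, h2⟩} := by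
        ext x
        simp only [Finset.mem_filter, Finset.mem_univ, true_and, Finset.mem_insert,
          Finset.mem_singleton, Fin.ext_iff, hvd, gl]
        split_ifs <;> omega
      rw [this, Finset.sum_pair (by simp [Fin.ext_iff]; omega)]
      have g1 : (gl d c ⟨d - 1, h1⟩).1 = d := by simp only [gl]; split_ifs <;> omega
      have g3 : d - 1 < d := by omega
      simp [hw, g1, g3, Fc, hvd, add_comm]
    · obtain ⟨x, hx⟩ : ∃ x, Finset.univ.filter (fun x => gl d c x = v) = {x} := by
        have h' : (lab d v).1 ≠ c.1 := fun e => h (Fin.ext e)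
        simp only [lab] at h'
        refine ⟨⟨if v.1 < d then (if d < v.1 + c.1 then v.1 - 1 else v.1)
           else (if v.1 < d + c.1 then v.1 else v.1 - 1), ?_⟩, ?_⟩
        · split_ifs at h' ⊢ <;> omega
        · ext x
          have := x.2
          simp only [Finset.mem_filter, Finset.mem_univ, true_and,
            Finset.mem_singleton, Fin.ext_iff, gl]
          split_ifs at h' ⊢ <;> omega
      rw [hx, Finset.sum_singleton]
      have hm : x ∈ Finset.univ.filter (fun x => gl d c x = v) := by rw [hx]; simp
      have hm := (Finset.mem_filter.1 hm).2
      rw [hw_ncol _ _ _ _ _ _ (by rw [hm]; exact hvd)]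
      simp [Fc, hvd]

/-- diagonal scalar -/
def Du (Q q : ℂ) (d : ℕ) (u : Fin d → Fin (2 * d + 1)) : ℂ :=
  ∑ c : Fin (d + 1), ∏ j, (if lab d (u j) = c then 0 else Fc Q q d (u j) (cnt d u j))

lemma AtA (Q q : ℂ) (d : ℕ) (c : Fin (d + 1)) (y : (Fin d → Fin (2 * d + 1)) → ℂ)
    (u : Fin d → Fin (2 * d + 1)) :
    (Amat Q q d c).transpose.mulVec ((Amat Q q d c).mulVec y) u =
      (∏ j, (if lab d (u j) = c then 0 else Fc Q q d (u j) (cnt d u j))) * y u := by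
  simp_rw [← fiber_sum]
  rw [Finset.prod_univ_sum, Finset.sum_mul]
  simp only [Matrix.mulVec, dotProduct, Matrix.transpose_apply]
  have : ∀ w, (∑ v, Amat Q q d c w v * y v) = aw Q q d c w * y (gl d c ∘ w) :=
    fun w => Amat_mulVec Q q d c y w
  simp_rw [this]
  have hs : Fintype.piFinset (fun j => Finset.univ.filter (fun x => gl d c x = u j)) =
      Finset.univ.filter (fun w => u = gl d c ∘ w) := by
    ext w
    simp [Fintype.mem_piFinset, funext_iff, eq_comm]
  rw [hs, Finset.sum_filter]
  apply Finset.sum_congr rfl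
  intro w _
  unfold Amat
  split_ifs with h
  · rw [Finset.prod_pow, ← h]
    have : aw Q q d c w = ∏ j, hw Q q d c (w j) (cnt d u j) := by rw [aw, ← h]
    rw [this]; ring
  · simp

lemma Du_ne (Q q : ℂ) (hQ : Q ≠ 0) (hq : q ≠ 0)
    (hgen : ∀ a b : ℤ, (a, b) ≠ (0, 0) → Q ^ a * q ^ b ≠ 1) (d : ℕ)
    (u : Fin d → Fin (2 * d + 1)) : Du Q q d u ≠ 0 := by
  have h1 : ∀ c : Fin (d + 1),
      (∏ j, (if lab d (u j) = c then 0 else Fc Q q d (u j) (cnt d u j))) =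
      (if ∀ j, lab d (u j) ≠ c then 1 else 0) * ∏ j, Fc Q q d (u j) (cnt d u j) := by
    intro c
    split_ifs with h
    · rw [one_mul]
      exact Finset.prod_congr rfl (fun j _ => by rw [if_neg (h j)])
    · push Not at h
      obtain ⟨j, hj⟩ := h
      rw [zero_mul]
      exact Finset.prod_eq_zero (Finset.mem_univ j) (by rw [if_pos hj])
  unfold Du
  simp_rw [h1]
  rw [← Finset.sum_mul]
  apply mul_ne_zero
  · rw [Finset.sum_boole]
    rw [Nat.cast_ne_zero, ← Nat.pos_iff_ne_zero, Finset.card_pos]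
    by_contra hne
    rw [Finset.not_nonempty_iff_eq_empty, Finset.filter_eq_empty_iff] at hne
    have hsurj : Function.Surjective (fun j => lab d (u j)) := by
      intro c
      have := hne (Finset.mem_univ c)
      push Not at this
      exact this
    have := Fintype.card_le_of_surjective _ hsurj
    simp at this
  · rw [Finset.prod_ne_zero_iff]
    intro j _
    unfold Fc
    split_ifs
    · intro h
      set m := cnt d u j
      apply hgen 4 (4 * m) (by simp)
      have h2 : (Q⁻¹ * q⁻¹ ^ m) ^ 4 = 1 := by linear_combination ((Q⁻¹ * q⁻¹ ^ m) ^ 2 - 1) * h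
      have h3 : Q ^ (4 : ℤ) * q ^ (4 * (m : ℤ)) = ((Q⁻¹ * q⁻¹ ^ m) ^ 4)⁻¹ := by
        rw [mul_comm (4 : ℤ) (m : ℤ), zpow_mul]
        rw [zpow_natCast, mul_pow, mul_inv, ← inv_pow, ← inv_pow, inv_inv, ← inv_pow, inv_inv]
        norm_cast
      rw [h3, h2, inv_one]
    · exact one_ne_zero

/-- Over `ℂ` with generic `Q, q`, the `ℋ^B_{Q,q}(d)`-module
`V_{2d+1}^{⊗d}` is a direct summand of a finite direct sum of copies of
`V_{2d}^{⊗d}`. -/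
theorem V2d1_summand_of_V2d
    (Q q : ℂ) (hQ : Q ≠ 0) (hq : q ≠ 0)
    (hgen : ∀ a b : ℤ, (a, b) ≠ (0, 0) → Q ^ a * q ^ b ≠ 1)
    (d : ℕ) (hd : 1 ≤ d) :
    ∃ N : ℕ, 0 < N ∧
      ∃ (ι : ((Fin d → Fin (2 * d + 1)) → ℂ) →ₗ[ℂ] (Fin N → (Fin d → Fin (2 * d)) → ℂ))
        (π : (Fin N → (Fin d → Fin (2 * d)) → ℂ) →ₗ[ℂ] ((Fin d → Fin (2 * d + 1)) → ℂ)),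
        (∀ i < d, ∀ x, ι (TB Q q (2 * d + 1) d i x) = fun t => TB Q q (2 * d) d i (ι x t)) ∧
        (∀ i < d, ∀ y, π (fun t => TB Q q (2 * d) d i (y t)) = TB Q q (2 * d + 1) d i (π y)) ∧
        π.comp ι = LinearMap.id := by
  let ι : ((Fin d → Fin (2 * d + 1)) → ℂ) →ₗ[ℂ] (Fin (d + 1) → (Fin d → Fin (2 * d)) → ℂ) :=
    LinearMap.pi (fun c => (Amat Q q d c).mulVecLin)
  let π₀ : (Fin (d + 1) → (Fin d → Fin (2 * d)) → ℂ) →ₗ[ℂ] ((Fin d → Fin (2 * d + 1)) → ℂ) :=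
    ∑ c, (Amat Q q d c).transpose.mulVecLin.comp (LinearMap.proj c)
  let E : ((Fin d → Fin (2 * d + 1)) → ℂ) →ₗ[ℂ] ((Fin d → Fin (2 * d + 1)) → ℂ) :=
    LinearMap.pi (fun u => (Du Q q d u)⁻¹ • LinearMap.proj u)
  have hι : ∀ i < d, ∀ x, ι (TB Q q (2 * d + 1) d i x) = fun t => TB Q q (2 * d) d i (ι x t) := by
    intro i hi x
    funext c
    exact A_inter Q q hQ hq d c i hi x
  have hπ : ∀ i < d, ∀ y, π₀ (fun t => TB Q q (2 * d) d i (y t)) =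
      TB Q q (2 * d + 1) d i (π₀ y) := by
    intro i hi y
    simp only [π₀, LinearMap.sum_apply, LinearMap.comp_apply, LinearMap.proj_apply,
      Matrix.mulVecLin_apply, map_sum]
    exact Finset.sum_congr rfl (fun c _ => A_inter_mat Q q hQ hq d c i hi (y c))
  have hD : ∀ x u, π₀ (ι x) u = Du Q q d u * x u := by
    intro x u
    simp only [π₀, ι, LinearMap.sum_apply, LinearMap.comp_apply, LinearMap.proj_apply,
      Matrix.mulVecLin_apply, LinearMap.pi_apply, Finset.sum_apply, AtA, Du, Finset.sum_mul]
  have hne := Du_ne Q q hQ hq hgen d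
  have hE1 : ∀ x, E (π₀ (ι x)) = x := by
    intro x
    funext u
    simp [E, hD, hne u]
  have hE2 : ∀ x, π₀ (ι (E x)) = x := by
    intro x
    funext u
    simp [E, hD, hne u]
  have hET : ∀ i < d, ∀ x, E (TB Q q (2 * d + 1) d i x) = TB Q q (2 * d + 1) d i (E x) := by
    intro i hi x
    conv_lhs => rw [← hE2 x]
    rw [← hπ i hi, ← hι i hi, hE1]
  refine ⟨d + 1, Nat.succ_pos d, ι, E.comp π₀, hι, ?_, ?_⟩
  · intro i hi y
    rw [LinearMap.comp_apply, LinearMap.comp_apply, hπ i hi, hET i hi]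
  · ext1 x
    apply LinearMap.ext
    intro r
    exact hE1 _

end QSP
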